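/- arXiv:0908.2179 — 2 statements merged into one kernel-verified Lean document; each statement's English description precedes it below -/
import Mathlib

section
/- Let K be any field, let n ≥ 2 and d ≥ 1 be integers, and let S denote the matrix algebra M_d(L_K(n)). Then the identity element 1_S does not belong to [S⁻, S⁻] if and only if [S⁻, S⁻] is a simple Lie algebra. -/
noncomputable section

open scoped BigOperators

attribute [local instance 100] LieRing.ofAssociativeRing

/-- The defining relations of the Cohn algebra `C_K(n)`: `y_i x_j = δ_{ij} 1`.
Generators of the free algebra: `Sum.inl i` is `x_i`, `Sum.inr i` is `y_i`.
Quotienting by this relation is the same as quotienting by the two-sided ideal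
generated by the elements `y_i x_j - δ_{ij} 1`. -/
inductive CohnRel (K : Type) [Field K] (n : ℕ) :
    FreeAlgebra K (Fin n ⊕ Fin n) → FreeAlgebra K (Fin n ⊕ Fin n) → Prop
  | rel (i j : Fin n) : CohnRel K n
      (FreeAlgebra.ι K (Sum.inr i) * FreeAlgebra.ι K (Sum.inl j))
      (if i = j then 1 else 0)

/-- The Cohn algebra `C_K(n)`. -/
abbrev CohnAlgebra (K : Type) [Field K] (n : ℕ) := RingQuot (CohnRel K n)

/-- The generator `x_i` of the Cohn algebra. -/
def cX (K : Type) [Field K] (n : ℕ) (i : Fin n) : CohnAlgebra K n :=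
  RingQuot.mkAlgHom K (CohnRel K n) (FreeAlgebra.ι K (Sum.inl i))

/-- The generator `y_i` of the Cohn algebra. -/
def cY (K : Type) [Field K] (n : ℕ) (i : Fin n) : CohnAlgebra K n :=
  RingQuot.mkAlgHom K (CohnRel K n) (FreeAlgebra.ι K (Sum.inr i))

/-- `x_I` for a word `I` in the alphabet `{1, …, n}` (words are lists, the empty
list being the empty word, with `x_φ = 1`). -/
def xw (K : Type) [Field K] (n : ℕ) (I : List (Fin n)) : CohnAlgebra K n :=
  (I.map (cX K n)).prod

/-- `y_I` for a word `I`. -/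
def yw (K : Type) [Field K] (n : ℕ) (I : List (Fin n)) : CohnAlgebra K n :=
  (I.map (cY K n)).prod

/-- The Leavitt relation `∑ x_i y_i = 1`; quotienting `C_K(n)` by this relation is
the same as quotienting by the two-sided ideal `M` generated by `1 - ∑ x_i y_i`. -/
inductive LeavittRel (K : Type) [Field K] (n : ℕ) :
    CohnAlgebra K n → CohnAlgebra K n → Prop
  | rel : LeavittRel K n (∑ i : Fin n, cX K n i * cY K n i) 1

/-- The Leavitt algebra `L_K(n) = C_K(n)/M`. -/
abbrev LeavittAlgebra (K : Type) [Field K] (n : ℕ) := RingQuot (LeavittRel K n)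

/-- The canonical quotient map `C_K(n) → L_K(n)`, `z ↦ z̄`. -/
def leavittQuot (K : Type) [Field K] (n : ℕ) : CohnAlgebra K n →ₐ[K] LeavittAlgebra K n :=
  RingQuot.mkAlgHom K (LeavittRel K n)

/-- In a simple ring, an additive subgroup containing all `s * e * t` for a fixed `e ≠ 0` is
everything. -/
theorem mem_of_forall_mul_mul_mem {S : Type*} [Ring S] [IsSimpleRing S] {e : S} (he : e ≠ 0)
    (P : AddSubgroup S) (h : ∀ s t, s * e * t ∈ P) (a : S) : a ∈ P := by
  let T : TwoSidedIdeal S := TwoSidedIdeal.mk' {x | ∀ s t, s * x * t ∈ P}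
    (by simp) (fun hx hy s t ↦ by simpa [mul_add, add_mul] using P.add_mem (hx s t) (hy s t))
    (fun hx s t ↦ by simpa using P.neg_mem (hx s t))
    (fun {x _} hy s t ↦ by simpa [mul_assoc] using hy (s * x) t)
    (fun {_ y} hx s t ↦ by simpa [mul_assoc] using hx s (y * t))
  have hT : (1 : S) ∈ T :=
    IsSimpleRing.one_mem_of_ne_zero_mem T he ((TwoSidedIdeal.mem_mk' ..).2 h)
  simpa using (TwoSidedIdeal.mem_mk' ..).1 hT a 1

theorem mul_mul_mem_of_forall_mem {S : Type*} [Ring S] [IsSimpleRing S] {x y : S} (hx : x ≠ 0)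
    (hy : y ≠ 0) (V : AddSubgroup S) {f g : S} (h : ∀ r s t, f * s * x * r * y * t * g ∈ V)
    (a : S) : f * a * g ∈ V := by
  have h1 : ∀ t s, f * s * y * t * g ∈ V := fun t s ↦ by
    have := mem_of_forall_mul_mul_mem hx (V.comap ((AddMonoidHom.mulRight (y * t * g)).comp
      (AddMonoidHom.mulLeft f))) (fun s r ↦ by simpa [← mul_assoc] using h r s t) s
    simpa [← mul_assoc] using this
  exact mem_of_forall_mul_mul_mem hy (V.comap ((AddMonoidHom.mulRight g).comp
    (AddMonoidHom.mulLeft f))) (fun s t ↦ by simpa [← mul_assoc] using h1 t s) a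

theorem commutator_commutator_commutator {S : Type*} [Ring S] {u a b c : S} (hab : a * b = 0)
    (hba : b * a = 0) (hbc : b * c = 0) (hca : c * a = 0) (hcb : c * b = 0) :
    ((u * a - a * u) * b - b * (u * a - a * u)) * c - c * ((u * a - a * u) * b
      - b * (u * a - a * u)) = -(b * u * a * c) := by
  have : ((u * a - a * u) * b - b * (u * a - a * u)) * c - c * ((u * a - a * u) * b
      - b * (u * a - a * u)) = u * (a * b) * c - a * u * (b * c) - b * u * a * c + b * a * u * c
      - c * u * (a * b) + c * a * u * b + c * b * u * a - c * b * a * u := by noncomm_ring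
  rw [this]
  simp [hab, hba, hbc, hca, hcb]

namespace CompleteOrthogonalIdempotents

variable {S ι : Type*} [Ring S] [Fintype ι] {e : ι → S}

theorem mul_mul_self (he : CompleteOrthogonalIdempotents e) (i : ι) (a : S) :
    a * e i * e i = a * e i := by
  rw [mul_assoc, he.idem i]

theorem mul_mul_ne (he : CompleteOrthogonalIdempotents e) {i j : ι} (h : i ≠ j) (a : S) :
    a * e i * e j = 0 := by
  rw [mul_assoc, he.ortho h, mul_zero]

theorem mem_of_corner_mem (he : CompleteOrthogonalIdempotents e) (P : AddSubgroup S) {a : S}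
    (h : ∀ i j, e i * a * e j ∈ P) : a ∈ P := by
  have : a = ∑ i, ∑ j, e i * a * e j := by
    simp_rw [← Finset.mul_sum, he.complete, ← Finset.sum_mul, he.complete, one_mul, mul_one]
  rw [this]
  exact P.sum_mem fun i _ ↦ P.sum_mem fun j _ ↦ h i j

variable [IsSimpleRing S]

/-- A nonunital subring containing the off-diagonal Peirce corners is everything. -/
theorem mem_of_offDiag_mem (he : CompleteOrthogonalIdempotents e) (hne : ∀ i, e i ≠ 0)
    [Nontrivial ι] (T : NonUnitalSubring S) (hT : ∀ i j, i ≠ j → ∀ a, e i * a * e j ∈ T) (a : S) :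
    a ∈ T := by
  refine he.mem_of_corner_mem T.toAddSubgroup fun i j ↦ ?_
  obtain rfl | hij := eq_or_ne i j
  · obtain ⟨j, hj⟩ := exists_ne i
    refine mem_of_forall_mul_mul_mem (hne j) (T.toAddSubgroup.comap
      ((AddMonoidHom.mulRight (e i)).comp (AddMonoidHom.mulLeft (e i)))) (fun s t ↦ ?_) a
    have := T.mul_mem (hT i j hj.symm s) (hT j i hj t)
    simpa [← mul_assoc, he.mul_mul_self] using this
  · exact hT i j hij a

/-- An additive subgroup stable under commutation with the off-diagonal Peirce corners of a
simple ring, with at least three corners, is central or contains all commutators. -/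
theorem central_or_commutator_mem (he : CompleteOrthogonalIdempotents e) (hne : ∀ i, e i ≠ 0)
    (hι : 3 ≤ Fintype.card ι) (V : AddSubgroup S)
    (hV : ∀ u ∈ V, ∀ i j, i ≠ j → ∀ a, u * (e i * a * e j) - e i * a * e j * u ∈ V) :
    (∀ u ∈ V, ∀ a, u * a = a * u) ∨ ∀ a b, a * b - b * a ∈ V := by
  classical
  have : Nontrivial ι := Fintype.one_lt_card_iff_nontrivial.1 (by omega)
  have third : ∀ i k : ι, ∃ j, j ≠ i ∧ j ≠ k := fun i k ↦ by
    obtain ⟨j, -, hj⟩ := Finset.exists_mem_notMem_of_card_lt_card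
      (s := {i, k}) (t := Finset.univ) (by
        rw [Finset.card_univ]
        exact Finset.card_le_two.trans_lt (by omega))
    exact ⟨j, by simpa using hj⟩
  by_cases hoff : ∃ u ∈ V, ∃ i k, i ≠ k ∧ e k * u * e i ≠ 0
  · right
    obtain ⟨u, hu, i, k, hik, hx⟩ := hoff
    have start : ∀ a, e i * a * e k ∈ V := by
      obtain ⟨j, hji, hjk⟩ := third i k
      refine mul_mul_mem_of_forall_mem hx (hne j) V fun r s t ↦ ?_
      have key := V.neg_mem (hV _ (hV _ (hV u hu i j hji.symm r) i k hik s) j k hjk t)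
      have hab : e i * r * e j * (e i * s * e k) = 0 := by
        simp [← mul_assoc, he.mul_mul_ne hji]
      have hbc : e i * s * e k * (e j * t * e k) = 0 := by
        simp [← mul_assoc, he.mul_mul_ne hjk.symm]
      have hba : e i * s * e k * (e i * r * e j) = 0 := by
        simp [← mul_assoc, he.mul_mul_ne hik.symm]
      have hca : e j * t * e k * (e i * r * e j) = 0 := by
        simp [← mul_assoc, he.mul_mul_ne hik.symm]
      have hcb : e j * t * e k * (e i * s * e k) = 0 := by
        simp [← mul_assoc, he.mul_mul_ne hik.symm]
      rw [commutator_commutator_commutator hab hba hbc hca hcb, neg_neg] at key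
      simpa [← mul_assoc, he.mul_mul_self] using key
    have step : ∀ i k, i ≠ k → (∀ a, e i * a * e k ∈ V) → ∀ j, j ≠ i → j ≠ k →
        (∀ a, e i * a * e j ∈ V) ∧ ∀ a, e j * a * e k ∈ V := by
      intro i k hik h j hji hjk
      refine ⟨fun a ↦ ?_, fun a ↦ ?_⟩
      · refine mem_of_forall_mul_mul_mem (hne k) (V.comap ((AddMonoidHom.mulRight (e j)).comp
          (AddMonoidHom.mulLeft (e i)))) (fun s t ↦ ?_) a
        simpa [← mul_assoc, he.mul_mul_self, he.mul_mul_ne hji] using hV _ (h s) k j hjk.symm t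
      · refine mem_of_forall_mul_mul_mem (hne i) (V.comap ((AddMonoidHom.mulRight (e k)).comp
          (AddMonoidHom.mulLeft (e j)))) (fun s t ↦ ?_) a
        simpa [← mul_assoc, he.mul_mul_self, he.mul_mul_ne hjk.symm] using
          V.neg_mem (hV _ (h t) j i hji s)
    have row : ∀ l, l ≠ i → ∀ a, e i * a * e l ∈ V := fun l hl ↦ by
      obtain rfl | hlk := eq_or_ne l k
      · exact start
      · exact (step i k hik start l hl hlk).1
    have off : ∀ p q, p ≠ q → ∀ a, e p * a * e q ∈ V := by
      intro p q hpq
      obtain rfl | hp := eq_or_ne p i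
      · exact row q hpq.symm
      obtain rfl | hq := eq_or_ne q i
      · obtain ⟨l, hlp, hlq⟩ := third p q
        exact (step p l hlp.symm
          (step q l hlq.symm (row l hlq) p hp hlp.symm).2 q hp.symm hlq.symm).1
      · exact (step i q hq.symm (row q hq) p hp hpq).2
    let T : NonUnitalSubring S :=
      { carrier := {a | ∀ b, a * b - b * a ∈ V}
        zero_mem' := by simp
        add_mem' := fun {a a'} ha ha' b ↦ by
          convert V.add_mem (ha b) (ha' b) using 1; noncomm_ring
        neg_mem' := fun {a} ha b ↦ by
          convert V.neg_mem (ha b) using 1; noncomm_ring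
        mul_mem' := fun {a a'} ha ha' b ↦ by
          convert V.add_mem (ha (a' * b)) (ha' (b * a)) using 1; noncomm_ring }
    refine fun a ↦ he.mem_of_offDiag_mem hne T (fun p q hpq a b ↦ ?_) a
    refine he.mem_of_corner_mem (V.comap (AddMonoidHom.mulLeft (e p * a * e q) -
      AddMonoidHom.mulRight (e p * a * e q))) fun i j ↦ ?_
    simp only [AddSubgroup.mem_comap, AddMonoidHom.sub_apply, AddMonoidHom.coe_mulLeft,
      AddMonoidHom.coe_mulRight]
    obtain rfl | hij := eq_or_ne i j
    · refine V.sub_mem ?_ ?_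
      · obtain rfl | h := eq_or_ne i q
        · simpa [mul_assoc] using off p i hpq (a * (e i * (e i * b)))
        · simp [← mul_assoc, he.mul_mul_ne h.symm]
      · obtain rfl | h := eq_or_ne i p
        · simpa [mul_assoc] using off i q hpq (b * (e i * (e i * a)))
        · simp [← mul_assoc, he.mul_mul_ne h]
    · exact hV _ (off p q hpq a) i j hij b
  · left
    push Not at hoff
    intro u hu a
    suffices a ∈ NonUnitalSubring.centralizer {u} from
      NonUnitalSubring.mem_centralizer_iff.1 this u rfl
    refine he.mem_of_offDiag_mem hne _ (fun i j hij a ↦ ?_) a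
    rw [NonUnitalSubring.mem_centralizer_iff]
    simp only [Set.mem_singleton_iff, forall_eq]
    have hcol : u * e i = e i * u * e i := by
      rw [← Finset.sum_eq_single (s := Finset.univ) (f := fun k ↦ e k * u * e i) i
        (fun k _ hk ↦ hoff u hu i k hk.symm) (by simp), ← Finset.sum_mul, ← Finset.sum_mul,
        he.complete, one_mul]
    have hrow : e j * u = e j * u * e j := by
      rw [← Finset.sum_eq_single (s := Finset.univ) (f := fun k ↦ e j * u * e k) j
        (fun k _ hk ↦ hoff u hu k j hk) (by simp), ← Finset.mul_sum, he.complete, mul_one]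
    have h0 := hoff _ (hV u hu i j hij a) j i hij.symm
    rw [← sub_eq_zero, ← h0, mul_sub, sub_mul]
    congr 1
    · simp only [← mul_assoc, he.mul_mul_self]
      rw [hcol]
    · rw [mul_assoc _ (e j) u, hrow]
      simp only [← mul_assoc, (he.idem i).eq, he.mul_mul_self]

end CompleteOrthogonalIdempotents

theorem List.not_replicate_concat_prefix_append {α : Type*} {a b : α} (hab : a ≠ b) {N : ℕ}
    {t : List α} (ht : t ≠ []) (htN : t.length ≤ N) :
    ¬ List.replicate N a ++ [b] <+: t ++ (List.replicate N a ++ [b]) := by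
  intro h
  have hpos := List.length_pos_iff.2 ht
  have h1 := h.getElem (i := N) (by simp)
  rw [List.getElem_append_right (by simp), List.getElem_append_right htN,
    List.getElem_append_left (by simp; omega)] at h1
  simp at h1
  exact hab h1.symm

section LeavittFamily

variable {K L ι : Type*} [Field K] [Ring L] [Algebra K L] {x y : ι → L}

theorem prod_reverse_mul_prod_self [DecidableEq ι]
    (hyx : ∀ i j, y i * x j = if i = j then 1 else 0) (A : List ι) :
    (A.map y).reverse.prod * (A.map x).prod = 1 := by
  induction A with
  | nil => simp
  | cons i A ih =>
    calc _ = (A.map y).reverse.prod * (y i * x i) * (A.map x).prod := by simp [mul_assoc]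
      _ = 1 := by rw [hyx, if_pos rfl, mul_one, ih]

theorem prod_reverse_mul_prod_of_not_prefix [DecidableEq ι]
    (hyx : ∀ i j, y i * x j = if i = j then 1 else 0) {A B : List ι} (hl : A.length ≤ B.length)
    (h : ¬ A <+: B) : (A.map y).reverse.prod * (B.map x).prod = 0 := by
  induction A generalizing B with
  | nil => simp at h
  | cons i A ih =>
    cases B with
    | nil => simp at hl
    | cons j B =>
      have : ((i :: A).map y).reverse.prod * ((j :: B).map x).prod =
          (A.map y).reverse.prod * (y i * x j) * (B.map x).prod := by simp [mul_assoc]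
      rw [this, hyx]
      split_ifs with hij
      · rw [mul_one, ih (by simpa using hl)]
        simpa [hij] using h
      · simp

theorem eq_zero_of_mul_words_eq_zero [Fintype ι] (hxy : ∑ i, x i * y i = 1) (N : ℕ) {a : L}
    (h : ∀ J : List ι, J.length = N → a * (J.map x).prod = 0) : a = 0 := by
  induction N with
  | zero => simpa using h [] rfl
  | succ N ih =>
    refine ih fun J hJ ↦ ?_
    rw [← mul_one (a * _), ← hxy, Finset.mul_sum]
    refine Finset.sum_eq_zero fun i _ ↦ ?_
    have := h (J ++ [i]) (by simp [hJ])
    simp only [List.map_append, List.prod_append, List.map_cons, List.map_nil,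
      List.prod_singleton, ← mul_assoc] at this
    rw [← mul_assoc, this, zero_mul]

variable (K x) in
/-- The linear span of the words in a family `x`. -/
def wordSpan : Submodule K L := Submodule.span K (Set.range fun I : List ι ↦ (I.map x).prod)

theorem prod_mem_wordSpan (I : List ι) : (I.map x).prod ∈ wordSpan K x :=
  Submodule.subset_span ⟨I, rfl⟩

theorem exists_mul_word_mem_wordSpan [DecidableEq ι]
    (hyx : ∀ i j, y i * x j = if i = j then 1 else 0)
    (hgen : Algebra.adjoin K (Set.range x ∪ Set.range y) = ⊤) (a : L) :
    ∃ N, ∀ J : List ι, N ≤ J.length → a * (J.map x).prod ∈ wordSpan K x := by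
  have ha : a ∈ Algebra.adjoin K (Set.range x ∪ Set.range y) := hgen ▸ Algebra.mem_top
  induction ha using Algebra.adjoin_induction with
  | mem a ha =>
    obtain ⟨i, rfl⟩ | ⟨i, rfl⟩ := ha
    · exact ⟨0, fun J _ ↦ by simpa using prod_mem_wordSpan (K := K) (x := x) (i :: J)⟩
    · refine ⟨1, fun J hJ ↦ ?_⟩
      cases J with
      | nil => simp at hJ
      | cons j J =>
        rw [List.map_cons, List.prod_cons, ← mul_assoc, hyx]
        split_ifs
        · simpa using prod_mem_wordSpan J
        · simp
  | algebraMap r =>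
    refine ⟨0, fun J _ ↦ ?_⟩
    rw [← Algebra.smul_def]
    exact Submodule.smul_mem _ _ (prod_mem_wordSpan J)
  | add a b _ _ ha hb =>
    obtain ⟨N, hN⟩ := ha
    obtain ⟨M, hM⟩ := hb
    refine ⟨max N M, fun J hJ ↦ ?_⟩
    rw [add_mul]
    exact Submodule.add_mem _ (hN J (le_of_max_le_left hJ)) (hM J (le_of_max_le_right hJ))
  | mul a b _ _ ha hb =>
    obtain ⟨N, hN⟩ := ha
    obtain ⟨M, hM⟩ := hb
    refine ⟨M + N, fun J hJ ↦ ?_⟩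
    have hb := hM (J.take M) (by simp; omega)
    rw [← List.take_append_drop M J, List.map_append, List.prod_append, mul_assoc,
      ← mul_assoc b]
    generalize b * ((J.take M).map x).prod = c at hb
    induction hb using Submodule.span_induction with
    | mem c hc =>
      obtain ⟨I, rfl⟩ := hc
      simpa using hN (I ++ J.drop M) (by simp; omega)
    | zero => simp
    | add c d _ _ hc hd =>
      rw [add_mul, mul_add]
      exact Submodule.add_mem _ hc hd
    | smul r c _ hc =>
      rw [smul_mul_assoc, mul_smul_comm]
      exact Submodule.smul_mem _ _ hc

theorem exists_mul_mul_eq_one_of_mem_wordSpan [DecidableEq ι] [Nontrivial ι]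
    (hyx : ∀ i j, y i * x j = if i = j then 1 else 0) {p : L} (hp : p ∈ wordSpan K x)
    (h0 : p ≠ 0) : ∃ b c, b * p * c = 1 := by
  obtain ⟨f, rfl⟩ := Finsupp.mem_span_range_iff_exists_finsupp.1 hp
  have hf : f.support.Nonempty := by
    rw [Finsupp.support_nonempty_iff]
    rintro rfl
    simp at h0
  obtain ⟨I, hI, hmin⟩ := f.support.exists_min_image List.length hf
  obtain ⟨i, j, hij⟩ := exists_pair_ne ι
  let w := List.replicate (f.support.sup List.length) i ++ [j]
  refine ⟨(f I)⁻¹ • ((I ++ w).map y).reverse.prod, (w.map x).prod, ?_⟩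
  rw [Finsupp.sum, Finset.mul_sum, Finset.sum_mul, Finset.sum_eq_single_of_mem I hI]
  · have := prod_reverse_mul_prod_self hyx (I ++ w)
    rw [smul_mul_smul_comm, smul_mul_assoc, mul_assoc, ← List.prod_append, ← List.map_append,
      this, inv_mul_cancel₀ (Finsupp.mem_support_iff.1 hI), one_smul]
  · intro I' hI' hne
    have hl := hmin I' hI'
    rw [smul_mul_smul_comm, smul_mul_assoc, mul_assoc, ← List.prod_append, ← List.map_append,
      prod_reverse_mul_prod_of_not_prefix hyx (by simpa using hl), smul_zero]
    intro hpre
    obtain ⟨t, rfl⟩ : I <+: I' :=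
      List.prefix_of_prefix_length_le ((List.prefix_append I w).trans hpre)
        (List.prefix_append I' w) hl
    rw [List.append_assoc, List.prefix_append_right_inj] at hpre
    have hle := Finset.le_sup (f := List.length) hI'
    refine List.not_replicate_concat_prefix_append hij (by simpa using hne) ?_ hpre
    simp only [List.length_append] at hle
    omega

/-- An algebra generated by a Leavitt family with at least two pairs is simple. -/
theorem isSimpleRing_of_leavittFamily [Fintype ι] [DecidableEq ι] [Nontrivial ι] [Nontrivial L]
    (hyx : ∀ i j, y i * x j = if i = j then 1 else 0) (hxy : ∑ i, x i * y i = 1)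
    (hgen : Algebra.adjoin K (Set.range x ∪ Set.range y) = ⊤) : IsSimpleRing L := by
  refine IsSimpleRing.of_eq_bot_or_eq_top fun I ↦ or_iff_not_imp_left.2 fun hI ↦ ?_
  rw [← I.one_mem_iff]
  obtain ⟨a, haI, ha : a ≠ 0⟩ := SetLike.exists_of_lt (bot_lt_iff_ne_bot.mpr hI : ⊥ < I)
  obtain ⟨N, hN⟩ := exists_mul_word_mem_wordSpan hyx hgen a
  obtain ⟨J, hJ, hne⟩ : ∃ J : List ι, J.length = N ∧ a * (J.map x).prod ≠ 0 := by
    by_contra! h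
    exact ha (eq_zero_of_mul_words_eq_zero hxy N h)
  obtain ⟨b, c, hbc⟩ := exists_mul_mul_eq_one_of_mem_wordSpan hyx (hN J hJ.ge) hne
  rw [← hbc]
  exact I.mul_mem_right _ _ (I.mul_mem_left _ _ (I.mul_mem_right _ _ haI))

theorem CompleteOrthogonalIdempotents.of_leavittFamily [Fintype ι] [DecidableEq ι]
    (hyx : ∀ i j, y i * x j = if i = j then 1 else 0) (hxy : ∑ i, x i * y i = 1) :
    CompleteOrthogonalIdempotents
      fun p : ι × ι ↦ x p.1 * x p.2 * (y p.2 * y p.1) := by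
  refine CompleteOrthogonalIdempotents.iff_ortho_complete.2 ⟨fun p q hpq ↦ ?_, ?_⟩
  · have : x p.1 * x p.2 * (y p.2 * y p.1) * (x q.1 * x q.2 * (y q.2 * y q.1)) =
        x p.1 * x p.2 * (y p.2 * (y p.1 * x q.1) * x q.2) * (y q.2 * y q.1) := by
      simp only [mul_assoc]
    refine this.trans ?_
    rw [hyx]
    split_ifs with h1
    · rw [mul_one, hyx, if_neg fun h2 ↦ hpq (Prod.ext h1 h2), mul_zero, zero_mul]
    · simp
  · rw [Fintype.sum_prod_type]
    calc _ = ∑ i, x i * (∑ j, x j * y j) * y i := by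
          simp only [Finset.mul_sum, Finset.sum_mul, mul_assoc]
      _ = 1 := by simp [hxy]

theorem leavittFamily_idempotent_ne_zero [DecidableEq ι] [Nontrivial L]
    (hyx : ∀ i j, y i * x j = if i = j then 1 else 0) (i j : ι) :
    x i * x j * (y j * y i) ≠ 0 := by
  intro h
  have h1 : y j * y i * (x i * x j) = 1 := by
    simpa using prod_reverse_mul_prod_self hyx [i, j]
  have h2 : y j * y i * (x i * x j * (y j * y i)) * (x i * x j) = 1 := by
    rw [← mul_assoc (y j * y i), h1, one_mul, h1]
  simp [h] at h2

end LeavittFamily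

section DerivedAlgebra

variable {K S ι : Type*} [Field K] [Ring S] [Algebra K S]

theorem LieAlgebra.commutator_mem_derivedSeries_one (a b : S) :
    a * b - b * a ∈ LieAlgebra.derivedSeries K S 1 :=
  LieSubmodule.lie_mem_lie (LieSubmodule.mem_top a) (LieSubmodule.mem_top b)

theorem LieAlgebra.derivedSeries_one_induction {p : S → Prop}
    (hcomm : ∀ a b, p (a * b - b * a)) (hzero : p 0)
    (hadd : ∀ a b, p a → p b → p (a + b)) (hsmul : ∀ (r : K) a, p a → p (r • a)) {a : S}
    (ha : a ∈ LieAlgebra.derivedSeries K S 1) :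
    p a := by
  have ha' : a ∈ Submodule.span K {⁅x, y⁆ | (x : S) (y : S)} := by
    rw [← LieAlgebra.coe_derivedSeries_one_eq]
    exact ha
  clear ha
  induction ha' using Submodule.span_induction with
  | mem a ha =>
    obtain ⟨b, c, rfl⟩ := ha
    exact hcomm b c
  | zero => exact hzero
  | add a b _ _ ha hb => exact hadd a b ha hb
  | smul r a _ ha => exact hsmul r a ha

theorem LieAlgebra.central_mul_mem_derivedSeries_one {z w : S} (hw : ∀ a, w * a = a * w)
    (hz : z ∈ LieAlgebra.derivedSeries K S 1) : w * z ∈ LieAlgebra.derivedSeries K S 1 := by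
  refine derivedSeries_one_induction (K := K) (p := fun z ↦ w * z ∈ derivedSeries K S 1)
    (fun a b ↦ ?_) ?_ (fun a b ha hb ↦ ?_) (fun r a ha ↦ ?_) hz
  · convert commutator_mem_derivedSeries_one (K := K) (w * a) b using 1
    rw [mul_sub, ← mul_assoc, ← mul_assoc, ← mul_assoc, hw b]
  · simp
  · rw [mul_add]
    exact add_mem ha hb
  · rw [mul_smul_comm]
    exact SMulMemClass.smul_mem r ha

/-- In a simple ring, a nonzero central sum of commutators makes `1` a sum of commutators. -/
theorem LieAlgebra.one_mem_derivedSeries_one_of_central [IsSimpleRing S] {z : S} (hz0 : z ≠ 0)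
    (hzc : ∀ a, z * a = a * z) (hz : z ∈ LieAlgebra.derivedSeries K S 1) :
    (1 : S) ∈ LieAlgebra.derivedSeries K S 1 := by
  obtain ⟨w, hw⟩ := (IsSimpleRing.isField_center S).mul_inv_cancel
    (a := ⟨z, Subring.mem_center_iff.2 fun a ↦ (hzc a).symm⟩)
    (fun h ↦ hz0 (congrArg Subtype.val h))
  have hzw : z * w = 1 := congrArg Subtype.val hw
  rw [← hzw, hzc]
  exact central_mul_mem_derivedSeries_one (fun a ↦ (Subring.mem_center_iff.1 w.2 a).symm) hz

theorem LieAlgebra.one_notMem_derivedSeries_one_of_isSimple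
    [LieAlgebra.IsSimple K (LieAlgebra.derivedSeries K S 1)] :
    (1 : S) ∉ LieAlgebra.derivedSeries K S 1 := by
  intro h1
  let D := LieAlgebra.derivedSeries K S 1
  let I : LieIdeal K D :=
    { (Submodule.span K {(⟨1, h1⟩ : D)}) with
      lie_mem := fun {a m} hm ↦ by
        obtain ⟨r, rfl⟩ := Submodule.mem_span_singleton.1 hm
        have : ⁅a, r • (⟨1, h1⟩ : D)⁆ = 0 := Subtype.ext (by
          simp [LieRing.of_associative_ring_bracket])
        rw [this]
        exact Submodule.zero_mem _ }
  have hI : ∀ a : D, a ∈ I ↔ ∃ r : K, r • (⟨1, h1⟩ : D) = a := fun a ↦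
    Submodule.mem_span_singleton
  refine LieAlgebra.IsSimple.non_abelian K (L := D) ⟨fun a b ↦ ?_⟩
  obtain h | h := LieAlgebra.IsSimple.eq_bot_or_eq_top I
  · have h0 : (⟨1, h1⟩ : D) ∈ I := (hI _).2 ⟨1, one_smul _ _⟩
    rw [h, LieSubmodule.mem_bot] at h0
    have : Subsingleton S := subsingleton_of_zero_eq_one (congrArg Subtype.val h0).symm
    exact Subsingleton.elim _ _
  · obtain ⟨r, rfl⟩ := (hI a).1 (h ▸ LieSubmodule.mem_top a)
    exact Subtype.ext (by simp [LieRing.of_associative_ring_bracket])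

theorem CompleteOrthogonalIdempotents.isSimple_derivedSeries_one [IsSimpleRing S] [Fintype ι]
    {e : ι → S} (he : CompleteOrthogonalIdempotents e) (hne : ∀ i, e i ≠ 0)
    (hι : 3 ≤ Fintype.card ι) (h1 : (1 : S) ∉ LieAlgebra.derivedSeries K S 1) :
    LieAlgebra.IsSimple K (LieAlgebra.derivedSeries K S 1) := by
  have off : ∀ i j, i ≠ j → ∀ a, e i * a * e j ∈ LieAlgebra.derivedSeries K S 1 := by
    intro i j hij a
    have := LieAlgebra.commutator_mem_derivedSeries_one (K := K) (e i) (e i * a * e j)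
    simpa [← mul_assoc, (he.idem i).eq, he.mul_mul_ne hij.symm] using this
  refine ⟨fun I ↦ ?_, fun hab ↦ ?_⟩
  · let V : AddSubgroup S := I.toSubmodule.toAddSubgroup.map
      (LieAlgebra.derivedSeries K S 1).toSubmodule.subtype.toAddMonoidHom
    have hVI : ∀ a : LieAlgebra.derivedSeries K S 1, (a : S) ∈ V ↔ a ∈ I := by
      refine fun a ↦ ⟨?_, fun ha ↦ ⟨a, ha, rfl⟩⟩
      rintro ⟨b, hb, hba⟩
      rwa [← Subtype.ext hba]
    have hV : ∀ u ∈ V, ∀ i j, i ≠ j → ∀ a, u * (e i * a * e j) - e i * a * e j * u ∈ V := by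
      rintro _ ⟨w, hw, rfl⟩ i j hij a
      let u : LieAlgebra.derivedSeries K S 1 := w
      let v : LieAlgebra.derivedSeries K S 1 := ⟨_, off i j hij a⟩
      exact (hVI ⁅u, v⁆).2 (lie_mem_left K _ I u v hw)
    obtain hc | hc := he.central_or_commutator_mem hne hι V hV
    · left
      rw [LieSubmodule.eq_bot_iff]
      intro u hu
      by_contra hu0
      exact h1 (LieAlgebra.one_mem_derivedSeries_one_of_central
        (fun h ↦ hu0 (Subtype.ext h)) (hc u ((hVI u).2 hu)) u.2)
    · right
      refine eq_top_iff.2 fun u _ ↦ (hVI u).1 (LieAlgebra.derivedSeries_one_induction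
        (K := K) hc V.zero_mem (fun _ _ ↦ V.add_mem) (fun r a ↦ ?_) u.2)
      rintro ⟨b, hb, rfl⟩
      exact ⟨r • b, I.smul_mem r hb, rfl⟩
  · have : Nontrivial ι := Fintype.one_lt_card_iff_nontrivial.1 (by omega)
    obtain ⟨i, j, hij⟩ := exists_pair_ne ι
    refine hne i ?_
    have hz : ∀ a, e i * a * e i = 0 := fun a ↦
      mem_of_forall_mul_mul_mem (hne j) ((⊥ : AddSubgroup S).comap
        ((AddMonoidHom.mulRight (e i)).comp (AddMonoidHom.mulLeft (e i)))) (fun s t ↦ by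
          have h0 := congrArg (fun u ↦ e i * u.1) (hab.trivial
            ⟨_, off i j hij s⟩ ⟨_, off j i hij.symm t⟩)
          simpa [LieRing.of_associative_ring_bracket, mul_sub, ← mul_assoc, (he.idem i).eq,
            he.ortho hij, he.mul_mul_self] using h0) a
    simpa [(he.idem i).eq] using hz 1

theorem CompleteOrthogonalIdempotents.isSimple_derivedSeries_one_matrix [IsSimpleRing S]
    [Fintype ι] {e : ι → S} (he : CompleteOrthogonalIdempotents e) (hne : ∀ i, e i ≠ 0)
    (hι : 3 ≤ Fintype.card ι) {m : Type*} [Fintype m] [DecidableEq m] [Nonempty m]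
    (h1 : (1 : Matrix m m S) ∉ LieAlgebra.derivedSeries K (Matrix m m S) 1) :
    LieAlgebra.IsSimple K (LieAlgebra.derivedSeries K (Matrix m m S) 1) :=
  (he.map (Matrix.scalar m)).isSimple_derivedSeries_one
    (fun i ↦ (map_ne_zero_iff _ (RingHom.injective _)).2 (hne i)) hι h1

end DerivedAlgebra

section Leavitt

variable (K : Type) [Field K] (n : ℕ)

/-- The image of `x_i` in the Leavitt algebra. -/
def leavittX (i : Fin n) : LeavittAlgebra K n := leavittQuot K n (cX K n i)

/-- The image of `y_i` in the Leavitt algebra. -/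
def leavittY (i : Fin n) : LeavittAlgebra K n := leavittQuot K n (cY K n i)

theorem leavittY_mul_leavittX (i j : Fin n) :
    leavittY K n i * leavittX K n j = if i = j then 1 else 0 := by
  have h : cY K n i * cX K n j = if i = j then 1 else 0 := by
    rw [cY, cX, ← map_mul, RingQuot.mkAlgHom_rel K (CohnRel.rel i j)]
    split_ifs <;> simp
  rw [leavittY, leavittX, ← map_mul, h]
  split_ifs <;> simp

theorem sum_leavittX_mul_leavittY : ∑ i, leavittX K n i * leavittY K n i = 1 := by
  have h := RingQuot.mkAlgHom_rel K (LeavittRel.rel (K := K) (n := n))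
  simpa [leavittX, leavittY, leavittQuot] using h

theorem adjoin_leavitt_eq_top :
    Algebra.adjoin K (Set.range (leavittX K n) ∪ Set.range (leavittY K n)) = ⊤ := by
  let f : FreeAlgebra K (Fin n ⊕ Fin n) →ₐ[K] LeavittAlgebra K n :=
    (leavittQuot K n).comp (RingQuot.mkAlgHom K (CohnRel K n))
  have hf : Function.Surjective f :=
    (RingQuot.mkAlgHom_surjective K _).comp (RingQuot.mkAlgHom_surjective K _)
  rw [eq_top_iff, ← (AlgHom.range_eq_top f).2 hf, ← Algebra.map_top,
    ← FreeAlgebra.adjoin_range_ι, AlgHom.map_adjoin]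
  refine Algebra.adjoin_mono ?_
  rintro _ ⟨_, ⟨i | i, rfl⟩, rfl⟩
  · exact Or.inl ⟨i, rfl⟩
  · exact Or.inr ⟨i, rfl⟩

end Leavitt

/-- Proposition 3.7: `1_S ∉ [S⁻, S⁻]` iff `[S⁻, S⁻]` is a simple Lie algebra,
for `S = M_d(L_K(n))`. -/
theorem key_proposition (K : Type) [Field K] (n d : ℕ) (hn : 2 ≤ n) (hd : 1 ≤ d) :
    (1 : Matrix (Fin d) (Fin d) (LeavittAlgebra K n)) ∉
        LieAlgebra.derivedSeries K (Matrix (Fin d) (Fin d) (LeavittAlgebra K n)) 1 ↔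
    LieAlgebra.IsSimple K
      (LieAlgebra.derivedSeries K (Matrix (Fin d) (Fin d) (LeavittAlgebra K n)) 1) := by
  refine ⟨fun h1 ↦ ?_, fun _ ↦ LieAlgebra.one_notMem_derivedSeries_one_of_isSimple⟩
  have : NeZero d := ⟨by omega⟩
  have : Nontrivial (Fin n) := Fin.nontrivial_iff_two_le.2 hn
  have : Nontrivial (LeavittAlgebra K n) := by
    by_contra h
    have := not_nontrivial_iff_subsingleton.1 h
    exact h1 (Subsingleton.elim (0 : Matrix (Fin d) (Fin d) (LeavittAlgebra K n)) 1 ▸ zero_mem _)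
  have hyx := leavittY_mul_leavittX K n
  have hxy := sum_leavittX_mul_leavittY K n
  have : IsSimpleRing (LeavittAlgebra K n) :=
    isSimpleRing_of_leavittFamily hyx hxy (adjoin_leavitt_eq_top K n)
  have he := CompleteOrthogonalIdempotents.of_leavittFamily (L := LeavittAlgebra K n) hyx hxy
  refine he.isSimple_derivedSeries_one_matrix
    (fun p ↦ leavittFamily_idempotent_ne_zero (L := LeavittAlgebra K n) hyx p.1 p.2) ?_ h1
  rw [Fintype.card_prod, Fintype.card_fin]
  nlinarith
end
end

section
/- Let K be any field and n ≥ 2 an integer. Then the Lie subalgebra [L_K(n)⁻, L_K(n)⁻] is infinite dimensional as a K-vector space. -/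
noncomputable section

open scoped BigOperators

attribute [local instance 100] LieRing.ofAssociativeRing

/-- The operator `x_i` on functions on infinite words: extend by zero from the cylinder of words
starting with `i`. -/
def prependOp (K : Type) [Field K] (n : ℕ) (i : Fin n) :
    Module.End K ((ℕ → Fin n) → K) where
  toFun f s := if s 0 = i then f (fun k => s (k + 1)) else 0
  map_add' f g := by ext s; by_cases h : s 0 = i <;> simp [h]
  map_smul' c f := by ext s; by_cases h : s 0 = i <;> simp [h]

/-- The operator `y_i` on functions on infinite words: restrict to the cylinder of words
starting with `i`. -/
def restrictOp (K : Type) [Field K] (n : ℕ) (i : Fin n) :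
    Module.End K ((ℕ → Fin n) → K) where
  toFun f s := f (fun k => Nat.casesOn k i s)
  map_add' _ _ := rfl
  map_smul' _ _ := rfl

theorem restrictOp_mul_prependOp (K : Type) [Field K] (n : ℕ) (i j : Fin n) :
    restrictOp K n i * prependOp K n j = if i = j then 1 else 0 := by
  ext f s
  by_cases h : i = j <;> simp [restrictOp, prependOp, h]

theorem sum_prependOp_mul_restrictOp (K : Type) [Field K] (n : ℕ) :
    ∑ i, prependOp K n i * restrictOp K n i = 1 := by
  refine LinearMap.ext fun f => funext fun s => ?_
  simp only [LinearMap.sum_apply, Finset.sum_apply, prependOp, restrictOp, Module.End.mul_apply,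
    LinearMap.coe_mk, AddHom.coe_mk, Finset.sum_ite_eq, Finset.mem_univ, if_true,
    Module.End.one_apply]
  congr 1
  funext k
  cases k <;> rfl

/-- The representation of the Cohn algebra on functions on infinite words. -/
def cohnRep (K : Type) [Field K] (n : ℕ) :
    CohnAlgebra K n →ₐ[K] Module.End K ((ℕ → Fin n) → K) :=
  RingQuot.liftAlgHom K ⟨FreeAlgebra.lift K (Sum.elim (prependOp K n) (restrictOp K n)), by
    rintro _ _ ⟨i, j⟩
    rw [map_mul, FreeAlgebra.lift_ι_apply, FreeAlgebra.lift_ι_apply, Sum.elim_inl, Sum.elim_inr,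
      restrictOp_mul_prependOp]
    split_ifs <;> simp⟩

theorem cohnRep_cX (K : Type) [Field K] (n : ℕ) (i : Fin n) :
    cohnRep K n (cX K n i) = prependOp K n i := by
  simp [cohnRep, cX]

theorem cohnRep_cY (K : Type) [Field K] (n : ℕ) (i : Fin n) :
    cohnRep K n (cY K n i) = restrictOp K n i := by
  simp [cohnRep, cY]

/-- The representation of the Leavitt algebra on functions on infinite words. -/
def leavittRep (K : Type) [Field K] (n : ℕ) :
    LeavittAlgebra K n →ₐ[K] Module.End K ((ℕ → Fin n) → K) :=
  RingQuot.liftAlgHom K ⟨cohnRep K n, by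
    rintro _ _ ⟨⟩
    simp only [map_sum, map_mul, cohnRep_cX, cohnRep_cY, sum_prependOp_mul_restrictOp, map_one]⟩

theorem leavittRep_leavittQuot (K : Type) [Field K] (n : ℕ) (a : CohnAlgebra K n) :
    leavittRep K n (leavittQuot K n a) = cohnRep K n a := by
  simp [leavittRep, leavittQuot]

theorem cY_mul_cX (K : Type) [Field K] (n : ℕ) (i j : Fin n) :
    cY K n i * cX K n j = if i = j then 1 else 0 := by
  rw [cY, cX, ← map_mul, RingQuot.mkAlgHom_rel K (CohnRel.rel i j)]
  split_ifs <;> simp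

theorem prependOp_pow_apply (K : Type) [Field K] (n : ℕ) (i : Fin n) (k : ℕ)
    (f : (ℕ → Fin n) → K) (s : ℕ → Fin n) :
    (prependOp K n i ^ k) f s = if ∀ l < k, s l = i then f (fun l => s (l + k)) else 0 := by
  induction k generalizing s with
  | zero => simp
  | succ k ih =>
    rw [pow_succ', Module.End.mul_apply]
    change (if s 0 = i then (prependOp K n i ^ k) f (fun l => s (l + 1)) else 0) = _
    simp only [ih, Nat.forall_lt_succ_left']
    by_cases h : s 0 = i <;> simp [h, add_assoc]

theorem lie_pow_cX_cY (K : Type) [Field K] (n : ℕ) {i j : Fin n} (h : j ≠ i) (k : ℕ) :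
    ⁅cX K n i ^ (k + 1), cY K n j⁆ = cX K n i ^ (k + 1) * cY K n j := by
  rw [Ring.lie_def, pow_succ' _ k, ← mul_assoc (cY K n j), cY_mul_cX, if_neg h, zero_mul, sub_zero]

open scoped Classical in
/-- The matrix coefficients of `x_i ^ (k + 1) * y_j` between the constant word `j j j …` and the
words `i ^ (m + 1) j j j …` form the identity matrix. -/
theorem cohnRep_pow_cX_mul_cY_apply (K : Type) [Field K] (n : ℕ) {i j : Fin n} (h : j ≠ i)
    (k m : ℕ) :
    cohnRep K n (cX K n i ^ (k + 1) * cY K n j) (Pi.single (fun _ => j) 1)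
      (fun l => if l < m + 1 then i else j) = (Pi.single k 1 : ℕ → K) m := by
  have hy : restrictOp K n j (Pi.single (fun _ => j) 1) = Pi.single (fun _ => j) 1 := by
    funext s
    simp only [restrictOp, LinearMap.coe_mk, AddHom.coe_mk, Pi.single_apply]
    congr 1
    refine propext ⟨fun hs => funext fun l => congrFun hs (l + 1), ?_⟩
    rintro rfl
    funext l
    cases l <;> rfl
  rw [map_mul, map_pow, cohnRep_cX, cohnRep_cY, Module.End.mul_apply, hy, prependOp_pow_apply]
  simp only [Pi.single_apply]
  rcases lt_trichotomy m k with hlt | rfl | hgt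
  · rw [if_neg, if_neg hlt.ne]
    intro hall
    have := hall (m + 1) (by omega)
    simp [h] at this
  · rw [if_pos (fun l hl => if_pos hl), if_pos, if_pos rfl]
    funext l
    exact if_neg (by omega)
  · rw [if_neg hgt.ne']
    have : ¬ (fun l => if l + (k + 1) < m + 1 then i else j) = fun _ => j := by
      intro hc
      have := congrFun hc 0
      simp only [zero_add] at this
      rw [if_pos (by omega)] at this
      exact h this.symm
    rw [if_neg this, ite_self]

/-- Lemma 3.1(i): `[L_K(n)⁻, L_K(n)⁻]` is infinite dimensional over `K`. -/
theorem commutator_infinite_dimensional (K : Type) [Field K] (n : ℕ) (hn : 2 ≤ n) :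
    ¬ Module.Finite K (LieAlgebra.derivedSeries K (LeavittAlgebra K n) 1) := by
  classical
  intro hfin
  let i : Fin n := ⟨0, by omega⟩
  let j : Fin n := ⟨1, by omega⟩
  have hji : j ≠ i := by simp [i, j]
  let v : ℕ → LieAlgebra.derivedSeries K (LeavittAlgebra K n) 1 := fun k =>
    ⟨⁅leavittQuot K n (cX K n i ^ (k + 1)), leavittQuot K n (cY K n j)⁆,
      LieSubmodule.lie_mem_lie (LieSubmodule.mem_top _) (LieSubmodule.mem_top _)⟩
  let φ : LieAlgebra.derivedSeries K (LeavittAlgebra K n) 1 →ₗ[K] (ℕ → K) :=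
    LinearMap.pi fun m =>
      LinearMap.proj (fun l => if l < m + 1 then i else j) ∘ₗ
        LinearMap.applyₗ (Pi.single (fun _ => j) 1) ∘ₗ (leavittRep K n).toLinearMap ∘ₗ
          (LieAlgebra.derivedSeries K (LeavittAlgebra K n) 1).toSubmodule.subtype
  have hφ (k : ℕ) : φ (v k) = Pi.single k 1 := by
    funext m
    have hv : (v k : LeavittAlgebra K n) = leavittQuot K n (cX K n i ^ (k + 1) * cY K n j) := by
      rw [← lie_pow_cX_cY K n hji, Ring.lie_def, map_sub, map_mul, map_mul]
      rfl
    rw [← cohnRep_pow_cX_mul_cY_apply K n hji, ← leavittRep_leavittQuot, ← hv]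
    rfl
  have hli : LinearIndependent K v := by
    refine LinearIndependent.of_comp φ ?_
    rw [show φ ∘ v = fun k => Pi.single k 1 from funext hφ]
    exact Pi.linearIndependent_single_one ℕ K
  exact not_finite_iff_infinite.mpr (inferInstance : Infinite ℕ) hli.finite
end
end
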